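/- arXiv:0811.1667 — 2 statements merged into one kernel-verified Lean document; each statement's English description precedes it below -/
import Mathlib

section
/- Let n ∈ ℕ* and let η ∈ (0,1) be such that det(I_n + A) ≥ 1/2 for every matrix A ∈ M_n(ℝ) with max_{i,j} |A_{ij}| ≤ η. Let h : ℝ^n → ℝ^n be smooth with all partial derivatives of order ≥ 1 bounded on ℝ^n and with |∂_j h^i(x)| ≤ η/16 for all 1 ≤ i, j ≤ n and all x ∈ ℝ^n. Define g(x) := h(x) - h(0) - (dh)₀(x) and s := Id_{ℝ^n} + g. Then s is a C^∞ diffeomorphism of ℝ^n with s(0) = 0 and (ds)₀ = Id, and both s and s^{-1} belong to G₀(ℝ^n), i.e. all their partial derivatives of order ≥ 1 are bounded on ℝ^n. -/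
open MeasureTheory
open scoped BigOperators

noncomputable section

/-- Japanese bracket `⟨v⟩ = (1 + ‖v‖²)^(1/2)` (with the Euclidean norm). -/
def jb {n : ℕ} (v : Fin n → ℝ) : ℝ := Real.sqrt (1 + ∑ i, (v i) ^ 2)

/-- Japanese bracket of a pair of vectors, `⟨(x,y)⟩`. -/
def jb2 {n m : ℕ} (x : Fin n → ℝ) (y : Fin m → ℝ) : ℝ :=
  Real.sqrt (1 + ∑ i, (x i) ^ 2 + ∑ j, (y j) ^ 2)

/-- Euclidean inner product `⟨ϑ, ζ⟩`. -/
def ip {n : ℕ} (ϑ ζ : Fin n → ℝ) : ℝ := ∑ i, ϑ i * ζ i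

/-- Partial derivative in the `i`-th coordinate direction. -/
def pd {n : ℕ} {E : Type*} [NormedAddCommGroup E] [NormedSpace ℝ E]
    (i : Fin n) (f : (Fin n → ℝ) → E) : (Fin n → ℝ) → E :=
  fun x => fderiv ℝ f x (Pi.single i 1)

/-- Iterated partial derivative `∂^ν` along the multi-index `ν`. -/
def pdm {n : ℕ} {E : Type*} [NormedAddCommGroup E] [NormedSpace ℝ E]
    (ν : Fin n → ℕ) (f : (Fin n → ℝ) → E) : (Fin n → ℝ) → E :=
  (List.finRange n).foldr (fun i g => (pd i)^[ν i] g) f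

/-- Mixed partial derivative `∂_x^α ∂_y^β` of a function of two vector variables. -/
def pdm2 {n m : ℕ} {E : Type*} [NormedAddCommGroup E] [NormedSpace ℝ E]
    (α : Fin n → ℕ) (β : Fin m → ℕ) (f : (Fin n → ℝ) → (Fin m → ℝ) → E) :
    (Fin n → ℝ) → (Fin m → ℝ) → E :=
  fun x y => pdm α (fun x' => pdm β (f x') y) x

/-- Mixed partial derivative `∂_x^α ∂_y^β ∂_z^γ` of a function of three vector variables. -/
def pdm3 {n m k : ℕ} {E : Type*} [NormedAddCommGroup E] [NormedSpace ℝ E]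
    (α : Fin n → ℕ) (β : Fin m → ℕ) (γ : Fin k → ℕ)
    (f : (Fin n → ℝ) → (Fin m → ℝ) → (Fin k → ℝ) → E) :
    (Fin n → ℝ) → (Fin m → ℝ) → (Fin k → ℝ) → E :=
  fun x y z => pdm α (fun x' => pdm β (fun y' => pdm γ (f x' y') z) y) x

/-- Length `|ν|` of a multi-index. -/
def msize {n : ℕ} (ν : Fin n → ℕ) : ℕ := ∑ i, ν i

/-- The class `G_σ(ℝ^n, E)`: smooth functions whose `ν`-th derivative is
`O(⟨v⟩^{-σ(|ν|-1)})` for every `ν ≠ 0`. -/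
def GsigmaCl {n : ℕ} {E : Type*} [NormedAddCommGroup E] [NormedSpace ℝ E]
    (σ : ℝ) (f : (Fin n → ℝ) → E) : Prop :=
  ContDiff ℝ (⊤ : ℕ∞) f ∧ ∀ ν : Fin n → ℕ, ν ≠ 0 → ∃ C > 0, ∀ v,
    ‖pdm ν f v‖ ≤ C * jb v ^ (-(σ * ((msize ν : ℝ) - 1)))

/-- The class `S_σ(ℝ^n)`: smooth real functions whose `ν`-th derivative is
`O(⟨v⟩^{-σ|ν|})` for every `ν`. -/
def SsigmaCl {n : ℕ} (σ : ℝ) (f : (Fin n → ℝ) → ℝ) : Prop :=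
  ContDiff ℝ (⊤ : ℕ∞) f ∧ ∀ ν : Fin n → ℕ, ∃ C > 0, ∀ v,
    |pdm ν f v| ≤ C * jb v ^ (-(σ * (msize ν : ℝ)))

/-- `G_σ^×(ℝ^p)`: diffeomorphisms `g` of `ℝ^p` with `g` and `g⁻¹` in `G_σ`. -/
def GsigmaX {p : ℕ} (σ : ℝ) (g : (Fin p → ℝ) → (Fin p → ℝ)) : Prop :=
  ∃ h : (Fin p → ℝ) → (Fin p → ℝ),
    Function.LeftInverse h g ∧ Function.RightInverse h g ∧ GsigmaCl σ g ∧ GsigmaCl σ h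

/-- The class `O_M(ℝ^n, E)`: smooth functions with polynomially bounded derivatives. -/
def OMCl {n : ℕ} {E : Type*} [NormedAddCommGroup E] [NormedSpace ℝ E]
    (f : (Fin n → ℝ) → E) : Prop :=
  ContDiff ℝ (⊤ : ℕ∞) f ∧ ∀ ν : Fin n → ℕ, ∃ C > 0, ∃ k : ℕ, ∀ v,
    ‖pdm ν f v‖ ≤ C * jb v ^ (k : ℝ)

/-- `O_M^×(ℝ^p, ℝ^p)`: diffeomorphisms `g` of `ℝ^p` with `g` and `g⁻¹` in `O_M`. -/
def OMX {p : ℕ} (g : (Fin p → ℝ) → (Fin p → ℝ)) : Prop :=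
  ∃ h : (Fin p → ℝ) → (Fin p → ℝ),
    Function.LeftInverse h g ∧ Function.RightInverse h g ∧ OMCl g ∧ OMCl h

/-- The symbol space `S_σ^{l,m}(ℝ^{2n}, E)`. -/
def Ssym {n : ℕ} {E : Type*} [NormedAddCommGroup E] [NormedSpace ℝ E]
    (σ l m : ℝ) (a : (Fin n → ℝ) → (Fin n → ℝ) → E) : Prop :=
  ContDiff ℝ (⊤ : ℕ∞) (fun q : (Fin n → ℝ) × (Fin n → ℝ) => a q.1 q.2) ∧
  ∀ α β : Fin n → ℕ, ∃ C > 0, ∀ x ϑ,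
    ‖pdm2 α β a x ϑ‖ ≤ C * jb x ^ (σ * (l - (msize α : ℝ))) * jb ϑ ^ (m - (msize β : ℝ))

/-- The amplitude space `Π_{σ,κ}^{l,w,m}(ℝ^{3n}, E)`. -/
def Amp {n : ℕ} {E : Type*} [NormedAddCommGroup E] [NormedSpace ℝ E]
    (σ κ l w m : ℝ) (a : (Fin n → ℝ) → (Fin n → ℝ) → (Fin n → ℝ) → E) : Prop :=
  ContDiff ℝ (⊤ : ℕ∞)
    (fun q : ((Fin n → ℝ) × (Fin n → ℝ)) × (Fin n → ℝ) => a q.1.1 q.1.2 q.2) ∧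
  ∀ α β γ : Fin n → ℕ, ∃ C > 0, ∀ x ζ ϑ,
    ‖pdm3 α β γ a x ζ ϑ‖ ≤
      C * jb x ^ (σ * (l - ((msize α + msize β : ℕ) : ℝ))) *
        jb ζ ^ (w + κ * ((msize α + msize β : ℕ) : ℝ)) * jb ϑ ^ (m - (msize γ : ℝ))

/-- The space `H_{σ,κ}^{w}(E)` of smooth functions on `ℝ^{2n}`. -/
def Hsp {n : ℕ} {F : Type*} [NormedAddCommGroup F] [NormedSpace ℝ F]
    (σ κ w : ℝ) (g : (Fin n → ℝ) → (Fin n → ℝ) → F) : Prop :=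
  ContDiff ℝ (⊤ : ℕ∞) (fun q : (Fin n → ℝ) × (Fin n → ℝ) => g q.1 q.2) ∧
  ∀ α β : Fin n → ℕ, ¬(α = 0 ∧ β = 0) → ∃ C > 0, ∀ x ζ,
    ‖pdm2 α β g x ζ‖ ≤ C * jb x ^ (-(σ * (((msize α + msize β : ℕ) : ℝ) - 1))) *
      jb ζ ^ (w + κ * (((msize α + msize β : ℕ) : ℝ) - 1))

/-- The space `E_{σ,κ}^{w}(E)` of smooth functions on `ℝ^{2n}`. -/
def Esp {n : ℕ} {F : Type*} [NormedAddCommGroup F] [NormedSpace ℝ F]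
    (σ κ w : ℝ) (g : (Fin n → ℝ) → (Fin n → ℝ) → F) : Prop :=
  ContDiff ℝ (⊤ : ℕ∞) (fun q : (Fin n → ℝ) × (Fin n → ℝ) => g q.1 q.2) ∧
  ∀ α β : Fin n → ℕ, ∃ C > 0, ∀ x ζ,
    ‖pdm2 α β g x ζ‖ ≤ C * jb x ^ (-(σ * ((msize α + msize β : ℕ) : ℝ))) *
      jb ζ ^ (w + κ * ((msize α + msize β : ℕ) : ℝ))

/-- Jacobian determinant of a map `ℝ^p → ℝ^p`. -/
def Jdet {p : ℕ} (g : (Fin p → ℝ) → (Fin p → ℝ)) : (Fin p → ℝ) → ℝ :=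
  fun v => LinearMap.det (fderiv ℝ g v).toLinearMap

/-- The seminorm `q_{p,(α,β)}(K) = sup ⟨(x,y)⟩^p |∂^{(α,β)} K (x,y)|`. -/
def qSem {n : ℕ} (p : ℕ) (α β : Fin n → ℕ)
    (K : (Fin n → ℝ) → (Fin n → ℝ) → ℂ) : ℝ :=
  ⨆ q : (Fin n → ℝ) × (Fin n → ℝ), jb2 q.1 q.2 ^ p * ‖pdm2 α β K q.1 q.2‖

/-- Mixed partial derivative `∂_r^α ∂_θ^β` of a function of two real variables. -/
def pd2 (α β : ℕ) (F : ℝ → ℝ → ℝ) (r θ : ℝ) : ℝ :=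
  iteratedDeriv α (fun r' => iteratedDeriv β (fun θ' => F r' θ') θ) r

/-- Smooth real function on `ℝ` with all derivatives bounded. -/
def BddSmooth (a : ℝ → ℝ) : Prop :=
  ContDiff ℝ (⊤ : ℕ∞) a ∧ ∀ k : ℕ, ∃ C : ℝ, ∀ t, |iteratedDeriv k a t| ≤ C

/-- Inverse hyperbolic cosine, `arcosh x = log (x + √(x²-1))`. -/
def arcosh (x : ℝ) : ℝ := Real.log (x + Real.sqrt (x ^ 2 - 1))

/-- Iterated partial derivatives along a list of directions. -/
def pdl {n : ℕ} {E : Type*} [NormedAddCommGroup E] [NormedSpace ℝ E]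
    (l : List (Fin n)) (f : (Fin n → ℝ) → E) : (Fin n → ℝ) → E :=
  l.foldr (fun i g => pd i g) f

lemma pdl_append {n : ℕ} {E : Type*} [NormedAddCommGroup E] [NormedSpace ℝ E]
    (l l' : List (Fin n)) (f : (Fin n → ℝ) → E) : pdl (l ++ l') f = pdl l (pdl l' f) := by
  simp [pdl]

lemma pdl_replicate {n : ℕ} {E : Type*} [NormedAddCommGroup E] [NormedSpace ℝ E]
    (k : ℕ) (i : Fin n) (f : (Fin n → ℝ) → E) : pdl (List.replicate k i) f = (pd i)^[k] f := by
  induction k with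
  | zero => rfl
  | succ k ih =>
    rw [Function.iterate_succ_apply', ← ih]
    rfl

/-- The sorted list of directions attached to a multi-index. -/
def mlist {n : ℕ} (ν : Fin n → ℕ) : List (Fin n) :=
  (List.finRange n).flatMap (fun i => List.replicate (ν i) i)

lemma pdm_eq_pdl {n : ℕ} {E : Type*} [NormedAddCommGroup E] [NormedSpace ℝ E]
    (ν : Fin n → ℕ) (f : (Fin n → ℝ) → E) : pdm ν f = pdl (mlist ν) f := by
  unfold pdm mlist
  generalize List.finRange n = L
  induction L with
  | nil => rfl
  | cons a L ih =>
    rw [List.foldr_cons, ih, List.flatMap_cons, pdl_append, pdl_replicate]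

lemma pd_smooth {n : ℕ} {E : Type*} [NormedAddCommGroup E] [NormedSpace ℝ E]
    (i : Fin n) {f : (Fin n → ℝ) → E} (hf : ContDiff ℝ (⊤ : ℕ∞) f) :
    ContDiff ℝ (⊤ : ℕ∞) (pd i f) := by
  unfold pd
  exact (hf.fderiv_right (m := (⊤ : ℕ∞)) (by simp)).clm_apply contDiff_const

lemma pdl_smooth {n : ℕ} {E : Type*} [NormedAddCommGroup E] [NormedSpace ℝ E]
    (l : List (Fin n)) {f : (Fin n → ℝ) → E} (hf : ContDiff ℝ (⊤ : ℕ∞) f) :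
    ContDiff ℝ (⊤ : ℕ∞) (pdl l f) := by
  induction l with
  | nil => exact hf
  | cons a l ih => exact pd_smooth a ih

lemma pd_comm {n : ℕ} {E : Type*} [NormedAddCommGroup E] [NormedSpace ℝ E]
    (i j : Fin n) {f : (Fin n → ℝ) → E} (hf : ContDiff ℝ (⊤ : ℕ∞) f) :
    pd i (pd j f) = pd j (pd i f) := by
  have hd : Differentiable ℝ (fderiv ℝ f) :=
    (hf.fderiv_right (m := (⊤ : ℕ∞)) (by simp)).differentiable (by simp)
  have key : ∀ (a b : Fin n) x, pd a (pd b f) x =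
      fderiv ℝ (fderiv ℝ f) x (Pi.single a 1) (Pi.single b 1) := by
    intro a b x
    unfold pd
    rw [fderiv_clm_apply (hd x) (differentiableAt_const _)]
    simp
  funext x
  rw [key, key]
  have := (hf.contDiffAt (x := x)).isSymmSndFDerivAt (by
    simp only [minSmoothness_of_isRCLikeNormedField]
    exact WithTop.coe_le_coe.2 (le_top : (2 : ℕ∞) ≤ ⊤))
  exact this _ _

lemma pdl_perm {n : ℕ} {E : Type*} [NormedAddCommGroup E] [NormedSpace ℝ E]
    {l l' : List (Fin n)} (hl : l.Perm l') {f : (Fin n → ℝ) → E}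
    (hf : ContDiff ℝ (⊤ : ℕ∞) f) : pdl l f = pdl l' f := by
  induction hl with
  | nil => rfl
  | cons a _ ih => exact congrArg (pd a) ih
  | swap a b l => exact pd_comm b a (pdl_smooth l hf)
  | trans _ _ ih1 ih2 => exact ih1.trans ih2

lemma mlist_count {n : ℕ} (l : List (Fin n)) : (mlist (fun i => l.count i)).Perm l := by
  rw [List.perm_iff_count]
  intro a
  unfold mlist
  rw [List.count_flatMap]
  have : (List.count a ∘ fun i => List.replicate (List.count i l) i) =
      fun i => if i = a then List.count a l else 0 := by
    funext i
    simp only [Function.comp, List.count_replicate]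
    by_cases h : i = a <;> simp [h]
  rw [this, ← List.ofFn_eq_map, List.sum_ofFn]
  simp

lemma pdl_ofFn {n : ℕ} {E : Type*} [NormedAddCommGroup E] [NormedSpace ℝ E]
    {f : (Fin n → ℝ) → E} (hf : ContDiff ℝ (⊤ : ℕ∞) f) :
    ∀ (k : ℕ) (m : Fin k → Fin n) (x : Fin n → ℝ), pdl (List.ofFn m) f x =
      iteratedFDeriv ℝ k f x (fun i => Pi.single (m i) 1) := by
  intro k
  induction k with
  | zero => intro m x; simp [pdl]
  | succ k ih =>
    intro m x
    rw [List.ofFn_succ, iteratedFDeriv_succ_apply_left]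
    have h1 : pdl (List.ofFn fun i : Fin k => m i.succ) f =
        fun y => iteratedFDeriv ℝ k f y (fun i => Pi.single (m i.succ) 1) := by
      funext y; exact ih _ y
    change pd (m 0) (pdl (List.ofFn fun i : Fin k => m i.succ) f) x = _
    rw [h1]
    unfold pd
    have hd : DifferentiableAt ℝ (iteratedFDeriv ℝ k f) x :=
      (hf.differentiable_iteratedFDeriv (by exact_mod_cast WithTop.coe_lt_top k)) x
    rw [fderiv_continuousMultilinear_apply_const hd]
    rfl

/-- All derivatives of order at least one are bounded. -/
def BD {E F : Type*} [NormedAddCommGroup E] [NormedSpace ℝ E]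
    [NormedAddCommGroup F] [NormedSpace ℝ F] (f : E → F) : Prop :=
  ∀ k : ℕ, ∃ C : ℝ, ∀ x, ‖iteratedFDeriv ℝ k (fderiv ℝ f) x‖ ≤ C

lemma norm_le_basis {n k : ℕ} {E : Type*} [NormedAddCommGroup E] [NormedSpace ℝ E]
    (M : ContinuousMultilinearMap ℝ (fun _ : Fin k => Fin n → ℝ) E) :
    ‖M‖ ≤ ∑ r : Fin k → Fin n, ‖M (fun i => Pi.single (r i) 1)‖ := by
  classical
  refine ContinuousMultilinearMap.opNorm_le_bound (Finset.sum_nonneg fun _ _ => norm_nonneg _) ?_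
  intro v
  have hv : v = fun i => ∑ j, v i j • (Pi.single j 1 : Fin n → ℝ) := by
    funext i
    exact pi_eq_sum_univ' (v i)
  conv_lhs => rw [hv]
  rw [ContinuousMultilinearMap.map_sum, Finset.sum_mul]
  refine (norm_sum_le _ _).trans (Finset.sum_le_sum fun r _ => ?_)
  rw [ContinuousMultilinearMap.map_smul_univ, norm_smul, mul_comm]
  refine mul_le_mul_of_nonneg_left ?_ (norm_nonneg _)
  rw [norm_prod]
  exact Finset.prod_le_prod (fun _ _ => norm_nonneg _) fun i _ => norm_le_pi_norm (v i) (r i)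

lemma GsigmaCl_zero_iff {n : ℕ} {E : Type*} [NormedAddCommGroup E] [NormedSpace ℝ E]
    {f : (Fin n → ℝ) → E} : GsigmaCl 0 f ↔ ContDiff ℝ (⊤ : ℕ∞) f ∧ BD f := by
  unfold GsigmaCl
  refine and_congr_right fun hf => ?_
  constructor
  · intro H k
    have H' : ∀ r : Fin (k+1) → Fin n, ∃ C : ℝ, ∀ x,
        ‖iteratedFDeriv ℝ (k+1) f x (fun i => Pi.single (r i) 1)‖ ≤ C := by
      intro r
      obtain ⟨C, -, hC⟩ := H (fun i => (List.ofFn r).count i) (by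
        intro h0
        have h1 := congrFun h0 (r 0)
        simp only [Pi.zero_apply, List.count_eq_zero] at h1
        exact h1 (List.mem_ofFn.2 ⟨0, rfl⟩))
      refine ⟨C, fun x => ?_⟩
      have h2 := hC x
      rw [pdm_eq_pdl, pdl_perm (mlist_count _) hf, pdl_ofFn hf] at h2
      simpa using h2
    choose C hC using H'
    refine ⟨∑ r, C r, fun x => ?_⟩
    rw [norm_iteratedFDeriv_fderiv]
    exact (norm_le_basis _).trans (Finset.sum_le_sum fun r _ => hC r x)
  · intro H ν hν
    have hne : mlist ν ≠ [] := by
      obtain ⟨i, hi⟩ := Function.ne_iff.1 hν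
      have : i ∈ mlist ν := by
        unfold mlist
        rw [List.mem_flatMap]
        exact ⟨i, List.mem_finRange i, by simpa using hi⟩
      exact List.ne_nil_of_mem this
    obtain ⟨k, hk⟩ : ∃ k, (mlist ν).length = k + 1 :=
      Nat.exists_eq_succ_of_ne_zero (by simpa using hne)
    obtain ⟨C, hC⟩ := H k
    refine ⟨max C 1, by positivity, fun x => ?_⟩
    have h0 : pdm ν f x = iteratedFDeriv ℝ (mlist ν).length f x
        (fun i => Pi.single ((mlist ν).get i) 1) := by
      rw [← pdl_ofFn hf, List.ofFn_get, pdm_eq_pdl]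
    rw [h0]
    refine (ContinuousMultilinearMap.le_opNorm _ _).trans ?_
    have h1 := hC x
    rw [norm_iteratedFDeriv_fderiv, ← hk] at h1
    have h2 : ∏ i, ‖(Pi.single ((mlist ν).get i) 1 : Fin n → ℝ)‖ = 1 := by
      refine Finset.prod_eq_one fun i _ => ?_
      rw [Pi.norm_single, norm_one]
    rw [h2]
    simpa using Or.inl h1

lemma BD_inverse {E : Type*} [NormedAddCommGroup E] [NormedSpace ℝ E] [FiniteDimensional ℝ E]
    {s t : E → E} (hs : ContDiff ℝ (⊤ : ℕ∞) s) (ht : ContDiff ℝ (⊤ : ℕ∞) t)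
    (hst : ∀ y, s (t y) = y) (hB : BD s)
    (hn : ∀ x, ‖fderiv ℝ s x - ContinuousLinearMap.id ℝ E‖ ≤ 1 / 16) : BD t := by
  have hunit : ∀ L : E →L[ℝ] E, ‖L - ContinuousLinearMap.id ℝ E‖ ≤ 1 / 16 → IsUnit L := by
    intro L hL
    have := isUnit_one_sub_of_norm_lt_one (x := ContinuousLinearMap.id ℝ E - L)
      (by rw [norm_sub_rev]; linarith)
    rwa [show (1 : E →L[ℝ] E) - (ContinuousLinearMap.id ℝ E - L) = L from sub_sub_cancel _ _]
      at this
  have hsd : Differentiable ℝ s := hs.differentiable (by simp)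
  have htd : Differentiable ℝ t := ht.differentiable (by simp)
  have hds : ContDiff ℝ (⊤ : ℕ∞) (fderiv ℝ s) := hs.fderiv_right (by simp)
  set P : E → (E →L[ℝ] E) := fderiv ℝ s ∘ t with hP
  have hPs : ContDiff ℝ (⊤ : ℕ∞) P := hds.comp ht
  have hdt : fderiv ℝ t = Ring.inverse ∘ P := by
    funext y
    have h1 : P y * fderiv ℝ t y = 1 := by
      have h2 : HasFDerivAt (fun y => s (t y)) (P y * fderiv ℝ t y) y :=
        (hsd (t y)).hasFDerivAt.comp y (htd y).hasFDerivAt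
      have h3 : (fun y => s (t y)) = id := funext hst
      rw [h3] at h2
      exact h2.unique (hasFDerivAt_id y)
    have h4 : IsUnit (P y) := hunit _ (hn (t y))
    have h5 : Ring.inverse (P y) * (P y * fderiv ℝ t y) = fderiv ℝ t y := by
      rw [← mul_assoc, Ring.inverse_mul_cancel _ h4, one_mul]
    rw [h1, mul_one] at h5
    exact h5.symm
  set U : Set (E →L[ℝ] E) := {L | IsUnit L} with hU
  have hUo : IsOpen U := Units.isOpen
  have hinv : ContDiffOn ℝ (⊤ : ℕ∞) (Ring.inverse : (E →L[ℝ] E) → (E →L[ℝ] E)) U := by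
    rintro L ⟨u, rfl⟩
    exact (contDiffAt_ringInverse ℝ u).contDiffWithinAt
  have hK : IsCompact (Metric.closedBall (ContinuousLinearMap.id ℝ E) (1 / 16 : ℝ)) :=
    isCompact_closedBall _ _
  have hKU : Metric.closedBall (ContinuousLinearMap.id ℝ E) (1 / 16 : ℝ) ⊆ U := by
    intro L hL
    exact hunit L (by simpa [dist_eq_norm] using hL)
  have hib : ∀ i : ℕ, ∃ C : ℝ, ∀ y,
      ‖iteratedFDerivWithin ℝ i (Ring.inverse : (E →L[ℝ] E) → (E →L[ℝ] E)) U (P y)‖ ≤ C := by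
    intro i
    have hc := (hinv.continuousOn_iteratedFDerivWithin (m := i)
      (by exact_mod_cast le_top) hUo.uniqueDiffOn).mono hKU
    obtain ⟨C, hC⟩ := hK.exists_bound_of_continuousOn hc
    exact ⟨C, fun y => hC _ (by rw [Metric.mem_closedBall, dist_eq_norm]; exact hn (t y))⟩
  choose CI hCI using hib
  choose CS hCS using hB
  intro k
  induction k using Nat.strong_induction_on with
  | _ k ih =>
  have ih' : ∀ j : ℕ, ∃ C : ℝ, j < k → ∀ x, ‖iteratedFDeriv ℝ j (fderiv ℝ t) x‖ ≤ C := by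
    intro j
    by_cases hj : j < k
    · obtain ⟨C, hC⟩ := ih j hj
      exact ⟨C, fun _ => hC⟩
    · exact ⟨0, fun h => absurd h hj⟩
  choose CT hCT using ih'
  have unif : ∀ c : ℕ → ℝ, ∃ D : ℝ, 1 ≤ D ∧ ∀ i ≤ k, c i ≤ D := by
    intro c
    refine ⟨1 + ∑ i ∈ Finset.range (k+1), |c i|, ?_, ?_⟩
    · have := Finset.sum_nonneg (s := Finset.range (k+1)) fun i _ => abs_nonneg (c i)
      linarith
    · intro i hi
      have := Finset.single_le_sum (s := Finset.range (k+1)) (f := fun i => |c i|)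
        (fun i _ => abs_nonneg (c i)) (Finset.mem_range.2 (Nat.lt_succ_of_le hi))
      have h2 := le_abs_self (c i)
      linarith
  obtain ⟨D1, hD1, hD1'⟩ := unif CT
  obtain ⟨D2, hD2, hD2'⟩ := unif CS
  obtain ⟨D3, hD3, hD3'⟩ := unif CI
  have ht' : ∀ x i, 1 ≤ i → i ≤ k → ‖iteratedFDeriv ℝ i t x‖ ≤ D1 ^ i := by
    intro x i h1 hi
    obtain ⟨j, rfl⟩ : ∃ j, i = j + 1 := ⟨i - 1, by omega⟩
    rw [← norm_iteratedFDeriv_fderiv]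
    exact (hCT j (by omega) x).trans ((hD1' j (by omega)).trans
      (le_self_pow₀ hD1 (by omega)))
  have hPb : ∀ x i, i ≤ k → ‖iteratedFDeriv ℝ i P x‖ ≤ (i.factorial : ℝ) * D2 * D1 ^ i := by
    intro x i hi
    refine norm_iteratedFDeriv_comp_le (N := (⊤ : ℕ∞)) hds ht (by exact_mod_cast le_top) x ?_ ?_
    · intro j hj
      exact (hCS j _).trans (hD2' j (by omega))
    · intro j h1 hj
      exact ht' x j h1 (by omega)
  obtain ⟨D4, hD4, hD4'⟩ := unif (fun i => (i.factorial : ℝ) * D2 * D1 ^ i)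
  refine ⟨(k.factorial : ℝ) * D3 * D4 ^ k, fun x => ?_⟩
  rw [hdt]
  refine norm_iteratedFDeriv_comp_le' (N := (⊤ : ℕ∞)) (t := U) ?_ hUo.uniqueDiffOn hinv hPs
    (by exact_mod_cast le_top) x ?_ ?_
  · rintro _ ⟨y, rfl⟩
    exact hunit _ (hn (t y))
  · intro i hi
    exact (hCI i x).trans (hD3' i hi)
  · intro i h1 hi
    exact (hPb x i hi).trans ((hD4' i hi).trans (le_self_pow₀ hD4 (by omega)))

lemma eta_small {n : ℕ} (η : ℝ) (hη : 0 ≤ η)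
    (hdet : ∀ A : Matrix (Fin n) (Fin n) ℝ,
      (∀ i j, |A i j| ≤ η) → (1 / 2 : ℝ) ≤ (1 + A).det) : n * η ≤ 1 / 2 := by
  have h0 : ∀ i j, |(Matrix.replicateCol Unit (fun _ : Fin n => -η) *
      Matrix.replicateRow Unit (fun _ : Fin n => (1 : ℝ))) i j| ≤ η := by
    intro i j
    rw [Matrix.mul_apply]
    simp [abs_of_nonneg hη]
  have h1 := hdet _ h0
  rw [Matrix.det_one_add_replicateCol_mul_replicateRow] at h1
  simp [dotProduct] at h1
  linarith

/-- Construction of a `G₀^×` diffeomorphism from a small perturbation: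
with `h` smooth, all derivatives of order `≥ 1` bounded and `|∂_j h^i| ≤ η/16`,
the map `s = Id + (h - h(0) - (dh)₀)` is a bijective smooth map fixing `0` with
`(ds)₀ = Id`, and `s` together with any two-sided inverse lies in `G₀(ℝ^n)`. -/
theorem statement18 {n : ℕ} (hn : 0 < n) (η : ℝ) (hη : η ∈ Set.Ioo (0 : ℝ) 1)
    (hdet : ∀ A : Matrix (Fin n) (Fin n) ℝ,
      (∀ i j, |A i j| ≤ η) → (1 / 2 : ℝ) ≤ (1 + A).det)
    (h : (Fin n → ℝ) → (Fin n → ℝ))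
    (hG : GsigmaCl 0 h)
    (hsmall : ∀ (i j : Fin n) (x : Fin n → ℝ), |pd j h x i| ≤ η / 16) :
    Function.Bijective (fun x => x + (h x - h 0 - fderiv ℝ h 0 x)) ∧
    (fun x : Fin n → ℝ => x + (h x - h 0 - fderiv ℝ h 0 x)) 0 = 0 ∧
    fderiv ℝ (fun x => x + (h x - h 0 - fderiv ℝ h 0 x)) 0 =
      ContinuousLinearMap.id ℝ (Fin n → ℝ) ∧
    GsigmaCl 0 (fun x => x + (h x - h 0 - fderiv ℝ h 0 x)) ∧
    ∀ t : (Fin n → ℝ) → (Fin n → ℝ),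
      Function.LeftInverse t (fun x => x + (h x - h 0 - fderiv ℝ h 0 x)) →
      Function.RightInverse t (fun x => x + (h x - h 0 - fderiv ℝ h 0 x)) →
      GsigmaCl 0 t := by
  obtain ⟨hhs, hhB⟩ := GsigmaCl_zero_iff.1 hG
  obtain ⟨hη0, hη1⟩ := hη
  have hne := eta_small η hη0.le hdet
  have : Nonempty (Fin n) := ⟨⟨0, hn⟩⟩
  have hhd : Differentiable ℝ h := hhs.differentiable (by simp)
  have hdh : ContDiff ℝ (⊤ : ℕ∞) (fderiv ℝ h) := hhs.fderiv_right (by simp)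
  set s : (Fin n → ℝ) → (Fin n → ℝ) := fun x => x + (h x - h 0 - fderiv ℝ h 0 x) with hs
  have hss : ContDiff ℝ (⊤ : ℕ∞) s :=
    contDiff_id.add ((hhs.sub contDiff_const).sub (fderiv ℝ h 0).contDiff)
  have hsD : ∀ x, HasFDerivAt s
      (ContinuousLinearMap.id ℝ (Fin n → ℝ) + (fderiv ℝ h x - fderiv ℝ h 0)) x := by
    intro x
    exact (hasFDerivAt_id x).add
      (((hhd x).hasFDerivAt.sub_const (h 0)).sub (fderiv ℝ h 0).hasFDerivAt)
  have hnorm : ∀ x, ‖fderiv ℝ h x‖ ≤ 1 / 32 := by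
    intro x
    refine ContinuousLinearMap.opNorm_le_bound _ (by norm_num) fun v => ?_
    refine (pi_norm_le_iff_of_nonneg (by positivity)).2 fun i => ?_
    have hv : v = ∑ j, v j • (Pi.single j 1 : Fin n → ℝ) := pi_eq_sum_univ' v
    have h1 : fderiv ℝ h x v i = ∑ j, v j * pd j h x i := by
      conv_lhs => rw [hv]
      simp only [map_sum, map_smul, Finset.sum_apply, Pi.smul_apply, smul_eq_mul]
      rfl
    rw [h1]
    calc ‖∑ j, v j * pd j h x i‖ ≤ ∑ j : Fin n, ‖v‖ * (η / 16) := by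
          refine (norm_sum_le _ _).trans (Finset.sum_le_sum fun j _ => ?_)
          rw [norm_mul]
          exact mul_le_mul (norm_le_pi_norm v j) (hsmall i j x) (norm_nonneg _) (norm_nonneg _)
      _ = (n * η) / 16 * ‖v‖ := by simp; ring
      _ ≤ 1 / 32 * ‖v‖ := mul_le_mul_of_nonneg_right (by linarith) (norm_nonneg _)
  have hsn : ∀ x, ‖fderiv ℝ s x - ContinuousLinearMap.id ℝ (Fin n → ℝ)‖ ≤ 1 / 16 := by
    intro x
    rw [(hsD x).fderiv, add_sub_cancel_left]
    refine (norm_sub_le _ _).trans ?_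
    have := hnorm x
    have := hnorm 0
    linarith
  have hsB : BD s := by
    intro k
    obtain ⟨C, hC⟩ := hhB k
    set c := ContinuousLinearMap.id ℝ (Fin n → ℝ) - fderiv ℝ h 0 with hc
    have h1 : fderiv ℝ s = fderiv ℝ h + fun _ => c := by
      funext x
      rw [(hsD x).fderiv, Pi.add_apply, hc]
      abel
    refine ⟨C + ‖c‖, fun x => ?_⟩
    rw [h1, iteratedFDeriv_add_apply (hdh.contDiffAt.of_le (by exact_mod_cast le_top))
      contDiffAt_const]
    refine (norm_add_le _ _).trans (add_le_add (hC x) ?_)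
    rcases Nat.eq_zero_or_pos k with rfl | hk
    · simp
    · rw [iteratedFDeriv_const_of_ne hk.ne']
      simp
  have happ : ApproximatesLinearOn s
      ((ContinuousLinearEquiv.refl ℝ (Fin n → ℝ) : (Fin n → ℝ) ≃L[ℝ] (Fin n → ℝ)) :
        (Fin n → ℝ) →L[ℝ] (Fin n → ℝ)) Set.univ (1 / 16 : NNReal) := by
    intro x _ y _
    have := convex_univ.norm_image_sub_le_of_norm_fderiv_le' (𝕜 := ℝ) (f := s)
      (φ := ContinuousLinearMap.id ℝ (Fin n → ℝ)) (C := 1 / 16) (x := y) (y := x)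
      (fun z _ => (hsD z).differentiableAt) (fun z _ => hsn z) (Set.mem_univ _) (Set.mem_univ _)
    simpa using this
  let e := happ.toHomeomorph s (Or.inr (by
    have h1 : ‖((ContinuousLinearEquiv.refl ℝ (Fin n → ℝ)).symm :
        (Fin n → ℝ) →L[ℝ] (Fin n → ℝ))‖₊ = 1 := by
      simp
    rw [h1, inv_one, ← NNReal.coe_lt_coe]
    norm_num))
  have he : ∀ x, e x = s x := fun x => rfl
  have hunit : ∀ x, IsUnit (fderiv ℝ s x) := by
    intro x
    have := isUnit_one_sub_of_norm_lt_one
      (x := ContinuousLinearMap.id ℝ (Fin n → ℝ) - fderiv ℝ s x)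
      (by rw [norm_sub_rev]; linarith [hsn x])
    rwa [show (1 : (Fin n → ℝ) →L[ℝ] (Fin n → ℝ)) -
      (ContinuousLinearMap.id ℝ (Fin n → ℝ) - fderiv ℝ s x) = fderiv ℝ s x from
        sub_sub_cancel _ _] at this
  have hes : ContDiff ℝ (⊤ : ℕ∞) e.symm := by
    refine e.contDiff_symm (f₀' := fun x => ContinuousLinearEquiv.unitsEquiv ℝ _ (hunit x).unit)
      (fun x => ?_) hss
    exact (hsD x).differentiableAt.hasFDerivAt
  refine ⟨e.bijective, by simp [hs], ?_, GsigmaCl_zero_iff.2 ⟨hss, hsB⟩, ?_⟩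
  · rw [(hsD 0).fderiv]; simp
  · intro t hl hr
    have hte : t = e.symm := by
      funext y
      apply e.injective
      rw [e.apply_symm_apply, he]
      exact hr y
    have hts : ContDiff ℝ (⊤ : ℕ∞) t := hte ▸ hes
    exact GsigmaCl_zero_iff.2 ⟨hts, BD_inverse hss hts hr hsB hsn⟩
end
end

section
/- Let p = (x, y) ∈ ℝ² and θ ∈ ℝ. Define e_x(θ) := (1 + sinh²x · sin²θ)^{-1/2}, cos_x θ := e_x(θ) cos θ, sin_x θ := e_x(θ) sin θ, and the curve γ = (γ¹, γ²) : ℝ → ℝ² by γ¹(t) := arsinh( cosh t · sinh x + sinh t · cosh x · cos_x θ ) and γ²(t) := arsinh( ( cosh t · cosh x · sinh y + sinh t · ( sinh x · sinh y · cos_x θ + cosh x · cosh y · sin_x θ ) ) / cosh( γ¹(t) ) ). Then γ is smooth and satisfies, for all t ∈ ℝ, the geodesic system of the hyperbolic metric ds² = dx² + cosh²x dy²: (γ¹)''(t) - cosh(γ¹(t)) sinh(γ¹(t)) ((γ²)'(t))² = 0 and (γ²)''(t) + 2 tanh(γ¹(t)) (γ¹)'(t)(γ²)'(t) = 0, together with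 the initial conditions γ(0) = (x, y), (γ¹)'(0) = cos_x θ and (γ²)'(0) = sin_x θ. -/
open MeasureTheory
open scoped BigOperators

noncomputable section

theorem hyp_aux (a0 a1 b0 b1 c0 c1 L : ℝ) (hc0 : 0 < c0)
    (h0 : c0 ^ 2 = 1 + a0 ^ 2 + b0 ^ 2) (h1 : c1 ^ 2 = a1 ^ 2 + b1 ^ 2 - 1)
    (h01 : c0 * c1 = a0 * a1 + b0 * b1) (hL : L = b1 * c0 - b0 * c1)
    (hL2 : L ^ 2 = 1 + a0 ^ 2 - a1 ^ 2) (γ1 γ2 : ℝ → ℝ)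
    (hγ1 : γ1 = fun t => Real.arsinh (Real.cosh t * a0 + Real.sinh t * a1))
    (hγ2 : γ2 = fun t => Real.arsinh ((Real.cosh t * b0 + Real.sinh t * b1) /
        Real.cosh (γ1 t))) :
    ContDiff ℝ (⊤ : ℕ∞) γ1 ∧ ContDiff ℝ (⊤ : ℕ∞) γ2 ∧
    (∀ t, deriv (deriv γ1) t - Real.cosh (γ1 t) * Real.sinh (γ1 t) * (deriv γ2 t) ^ 2 = 0) ∧
    (∀ t, deriv (deriv γ2) t + 2 * Real.tanh (γ1 t) * deriv γ1 t * deriv γ2 t = 0) ∧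
    deriv γ1 0 = a1 / Real.sqrt (1 + a0 ^ 2) ∧ deriv γ2 0 = L / (1 + a0 ^ 2) := by
  obtain ⟨A, hA⟩ : ∃ A : ℝ → ℝ, A = fun t => Real.cosh t * a0 + Real.sinh t * a1 := ⟨_, rfl⟩
  obtain ⟨A', hA'⟩ : ∃ A' : ℝ → ℝ, A' = fun t => Real.sinh t * a0 + Real.cosh t * a1 := ⟨_, rfl⟩
  obtain ⟨B, hB⟩ : ∃ A : ℝ → ℝ, A = fun t => Real.cosh t * b0 + Real.sinh t * b1 := ⟨_, rfl⟩
  obtain ⟨B', hB'⟩ : ∃ A' : ℝ → ℝ, A' = fun t => Real.sinh t * b0 + Real.cosh t * b1 := ⟨_, rfl⟩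
  obtain ⟨C, hC⟩ : ∃ A : ℝ → ℝ, A = fun t => Real.cosh t * c0 + Real.sinh t * c1 := ⟨_, rfl⟩
  obtain ⟨R, hR⟩ : ∃ R : ℝ → ℝ, R = fun t => Real.sqrt (1 + A t ^ 2) := ⟨_, rfl⟩
  have dA : ∀ t, HasDerivAt A (A' t) t := fun t => by
    rw [hA, hA']
    exact ((Real.hasDerivAt_cosh t).mul_const a0).add ((Real.hasDerivAt_sinh t).mul_const a1)
  have dA' : ∀ t, HasDerivAt A' (A t) t := fun t => by
    rw [hA, hA']
    exact ((Real.hasDerivAt_sinh t).mul_const a0).add ((Real.hasDerivAt_cosh t).mul_const a1)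
  have dB : ∀ t, HasDerivAt B (B' t) t := fun t => by
    rw [hB, hB']
    exact ((Real.hasDerivAt_cosh t).mul_const b0).add ((Real.hasDerivAt_sinh t).mul_const b1)
  have hpos : ∀ t, 0 < 1 + A t ^ 2 := fun t => by positivity
  have Rpos : ∀ t, 0 < R t := fun t => by rw [hR]; exact Real.sqrt_pos.2 (hpos t)
  have Rsq : ∀ t, R t ^ 2 = 1 + A t ^ 2 := fun t => by rw [hR]; exact Real.sq_sqrt (hpos t).le
  have hcs : ∀ t, Real.cosh t ^ 2 = 1 + Real.sinh t ^ 2 := fun t => by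
    rw [Real.cosh_sq]; ring
  have hcc : c1 ^ 2 < c0 ^ 2 := by
    have e : c0 ^ 2 * c1 ^ 2 ≤ (c0 ^ 2 - 1) * (c1 ^ 2 + 1) := by
      rw [← mul_pow, h01, h0, h1]; nlinarith [sq_nonneg (a0 * b1 - b0 * a1)]
    nlinarith
  have Cpos : ∀ t, 0 < C t := fun t => by
    have e1 : |c1| < c0 := by rw [← abs_of_pos hc0]; exact sq_lt_sq.1 hcc
    have e2 : |Real.sinh t| < Real.cosh t := by
      rw [← abs_of_pos (Real.cosh_pos t)]; exact sq_lt_sq.1 (by rw [hcs]; linarith)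
    have e3 : |Real.sinh t * c1| < Real.cosh t * c0 := by
      rw [abs_mul]; exact mul_lt_mul'' e2 e1 (abs_nonneg _) (abs_nonneg _)
    rw [hC]; have := neg_abs_le (Real.sinh t * c1); dsimp only; linarith
  have Csq : ∀ t, C t ^ 2 = 1 + A t ^ 2 + B t ^ 2 := fun t => by
    rw [hC, hA, hB]; dsimp only
    linear_combination Real.cosh t ^ 2 * h0 + Real.sinh t ^ 2 * h1 +
      2 * Real.cosh t * Real.sinh t * h01 + hcs t
  have hLC : ∀ t, B' t * (1 + A t ^ 2) - B t * A t * A' t = L * C t := fun t => by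
    have e1 : A t * A' t + B t * B' t = C t * (Real.sinh t * c0 + Real.cosh t * c1) := by
      rw [hC, hA, hB, hA', hB']; dsimp only
      linear_combination -(Real.cosh t * Real.sinh t) * h0 - Real.cosh t * Real.sinh t * h1 -
        (Real.cosh t ^ 2 + Real.sinh t ^ 2) * h01
    have e2 : L = B' t * C t - B t * (Real.sinh t * c0 + Real.cosh t * c1) := by
      rw [hC, hB, hB', hL]; dsimp only
      linear_combination -(b1 * c0 - b0 * c1) * hcs t
    rw [e2]
    linear_combination -(B' t) * Csq t - B t * e1
  have hLA : ∀ t, 1 + A t ^ 2 - A' t ^ 2 = L ^ 2 := fun t => by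
    rw [hL2, hA, hA']; dsimp only
    linear_combination (a0 ^ 2 - a1 ^ 2) * hcs t
  have g1 : γ1 = fun t => Real.arsinh (A t) := by rw [hγ1, hA]
  have hcosh : ∀ t, Real.cosh (γ1 t) = R t := fun t => by rw [g1, hR]; exact Real.cosh_arsinh _
  have hsinh : ∀ t, Real.sinh (γ1 t) = A t := fun t => by rw [g1]; exact Real.sinh_arsinh _
  have g2 : γ2 = fun t => Real.arsinh (B t / R t) := by
    rw [hγ2]; funext t; rw [hcosh, hB]
  have dR : ∀ t, HasDerivAt R (A t * A' t / R t) t := fun t => by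
    have := (((dA t).pow 2).const_add 1).sqrt (hpos t).ne'
    rw [hR]
    refine HasDerivAt.congr_deriv (f := fun t => Real.sqrt (1 + A t ^ 2)) this ?_
    simp only [Nat.cast_ofNat, Nat.add_one_sub_one, pow_one, Pi.pow_apply]
    have := Real.sqrt_pos.2 (hpos t)
    field_simp
  have d1 : ∀ t, HasDerivAt γ1 (A' t / R t) t := fun t => by
    rw [g1]
    convert (dA t).arsinh using 1
    rw [hR, smul_eq_mul]; ring
  have d2 : ∀ t, HasDerivAt γ2 (L / R t ^ 2) t := fun t => by
    rw [g2]
    have := ((dB t).div (dR t) (Rpos t).ne').arsinh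
    refine HasDerivAt.congr_deriv (f := fun t => Real.arsinh (B t / R t)) this ?_
    have r := Rpos t
    have c := Cpos t
    have e : Real.sqrt (1 + (B t / R t) ^ 2) = C t / R t := by
      rw [show 1 + (B t / R t) ^ 2 = (C t / R t) ^ 2 by
        field_simp; rw [Csq, Rsq]]
      exact Real.sqrt_sq (by positivity)
    simp only [Pi.div_apply, smul_eq_mul]
    rw [e]
    have h := hLC t
    rw [← Rsq] at h
    field_simp
    linear_combination h
  have D1 : deriv γ1 = fun t => A' t / R t := funext fun t => (d1 t).deriv
  have D2 : deriv γ2 = fun t => L / R t ^ 2 := funext fun t => (d2 t).deriv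
  have cA : ContDiff ℝ (⊤ : ℕ∞) A := by
    rw [hA]
    exact (Real.contDiff_cosh.mul contDiff_const).add (Real.contDiff_sinh.mul contDiff_const)
  have cB : ContDiff ℝ (⊤ : ℕ∞) B := by
    rw [hB]
    exact (Real.contDiff_cosh.mul contDiff_const).add (Real.contDiff_sinh.mul contDiff_const)
  have cR : ContDiff ℝ (⊤ : ℕ∞) R := by
    rw [hR]
    exact (contDiff_const.add (cA.pow 2)).sqrt fun t => (hpos t).ne'
  refine ⟨?_, ?_, ?_, ?_, ?_, ?_⟩
  · rw [g1]; exact cA.arsinh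
  · rw [g2]; exact (cB.div cR fun t => (Rpos t).ne').arsinh
  · intro t
    have r := Rpos t
    have h := ((dA' t).div (dR t) r.ne').deriv
    rw [D1, D2, hcosh, hsinh]
    have h' : deriv (fun t => A' t / R t) t = _ := h
    rw [h', ]
    have e := hLA t
    rw [← Rsq] at e
    field_simp
    linear_combination (A t) * e
  · intro t
    have r := Rpos t
    have h' : deriv (fun t => L / R t ^ 2) t = _ :=
      ((hasDerivAt_const t L).div ((dR t).pow 2) (pow_pos r 2).ne').deriv
    rw [D1, D2, Real.tanh_eq_sinh_div_cosh, hcosh, hsinh, h']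
    simp only [Pi.pow_apply, Nat.cast_ofNat, Nat.add_one_sub_one, pow_one]
    field_simp
    ring
  · rw [D1, hR, hA, hA']; simp
  · rw [D2]; dsimp only; rw [Rsq, hA]; simp

/-- The explicit curve `γ = (γ¹, γ²)` solves the geodesic system of
the hyperbolic metric `ds² = dx² + cosh²x dy²` with initial conditions
`γ(0) = (x,y)`, `γ'(0) = (cos_x θ, sin_x θ)`. -/
theorem statement19 (x y θ : ℝ) :
    let ex : ℝ := (Real.sqrt (1 + Real.sinh x ^ 2 * Real.sin θ ^ 2))⁻¹
    let cx : ℝ := ex * Real.cos θ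
    let sx : ℝ := ex * Real.sin θ
    let γ1 : ℝ → ℝ := fun t =>
      Real.arsinh (Real.cosh t * Real.sinh x + Real.sinh t * Real.cosh x * cx)
    let γ2 : ℝ → ℝ := fun t =>
      Real.arsinh ((Real.cosh t * Real.cosh x * Real.sinh y +
        Real.sinh t * (Real.sinh x * Real.sinh y * cx + Real.cosh x * Real.cosh y * sx)) /
        Real.cosh (γ1 t))
    ContDiff ℝ (⊤ : ℕ∞) γ1 ∧ ContDiff ℝ (⊤ : ℕ∞) γ2 ∧
    (∀ t, deriv (deriv γ1) t - Real.cosh (γ1 t) * Real.sinh (γ1 t) * (deriv γ2 t) ^ 2 = 0) ∧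
    (∀ t, deriv (deriv γ2) t + 2 * Real.tanh (γ1 t) * deriv γ1 t * deriv γ2 t = 0) ∧
    γ1 0 = x ∧ γ2 0 = y ∧ deriv γ1 0 = cx ∧ deriv γ2 0 = sx := by
  intro ex cx sx γ1 γ2
  have hq : 0 < 1 + Real.sinh x ^ 2 * Real.sin θ ^ 2 := by positivity
  have hex : ex ^ 2 * (1 + Real.sinh x ^ 2 * Real.sin θ ^ 2) = 1 := by
    simp only [ex]
    rw [inv_pow, Real.sq_sqrt hq.le, inv_mul_cancel₀ hq.ne']
  have hX := Real.cosh_sq x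
  have hY := Real.cosh_sq y
  have hT := Real.sin_sq_add_cos_sq θ
  have hunit : cx ^ 2 + Real.cosh x ^ 2 * sx ^ 2 = 1 := by
    simp only [cx, sx]
    linear_combination hex + ex ^ 2 * hT + ex ^ 2 * Real.sin θ ^ 2 * hX
  have h10 : γ1 0 = x := by simp [γ1]
  have h20 : γ2 0 = y := by
    simp only [γ2, h10]
    rw [Real.cosh_zero, Real.sinh_zero, one_mul, zero_mul, add_zero,
      mul_div_cancel_left₀ _ (Real.cosh_pos x).ne', Real.arsinh_sinh]
  have hcx := Real.cosh_pos x
  have hcy := Real.cosh_pos y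
  clear_value cx sx
  obtain ⟨p1, p2, p3, p4, p5, p6⟩ := hyp_aux (Real.sinh x) (Real.cosh x * cx)
    (Real.cosh x * Real.sinh y)
    (Real.sinh x * Real.sinh y * cx + Real.cosh x * Real.cosh y * sx)
    (Real.cosh x * Real.cosh y)
    (Real.sinh x * Real.cosh y * cx + Real.cosh x * Real.sinh y * sx)
    (Real.cosh x ^ 2 * sx) (by positivity)
    (by rw [mul_pow, mul_pow, hY]; linear_combination hX)
    (by linear_combination (Real.sinh x ^ 2 * cx ^ 2 - Real.cosh x ^ 2 * sx ^ 2) * hY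
          - cx ^ 2 * hX - hunit)
    (by linear_combination (Real.cosh x * Real.sinh x * cx) * hY)
    (by linear_combination (-(Real.cosh x ^ 2 * sx)) * hY)
    (by linear_combination (Real.cosh x ^ 2) * hunit + hX)
    γ1 γ2 (by funext t; simp only [γ1]; ring_nf) (by funext t; simp only [γ2]; ring_nf)
  have hs : 1 + Real.sinh x ^ 2 = Real.cosh x ^ 2 := by rw [hX]; ring
  refine ⟨p1, p2, p3, p4, h10, h20, ?_, ?_⟩
  · rw [p5, hs, Real.sqrt_sq hcx.le]; field_simp
  · rw [p6, hs]; field_simp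
end
end
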